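/- arXiv:2105.01020 — 3 statements merged into one kernel-verified Lean document; each statement's English description precedes it below -/
import Mathlib

section
/- Let K be an algebraically closed field of characteristic 0, let 𝔮 be a finite-dimensional Lie algebra over K, and let p ∈ K[t] be a monic polynomial of degree n ≥ 1. Then ind((K[t]/(p)) ⊗_K 𝔮) = n · ind 𝔮. -/
open TensorProduct Polynomial

/-- For a commutative `K`-algebra `A` and a Lie algebra `L` over `K`, the Lie algebra
`A ⊗[K] L` (with bracket `[f⊗x, g⊗y] = (fg) ⊗ [x,y]`) is also a Lie algebra over `K`. -/
noncomputable instance tensorLieAlgebraOfBase (K A L : Type*) [CommRing K] [CommRing A]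
    [Algebra K A] [LieRing L] [LieAlgebra K L] : LieAlgebra K (A ⊗[K] L) :=
  { (inferInstance : Module K (A ⊗[K] L)) with
    lie_smul := fun c x y => by
      rw [← algebraMap_smul A c y, lie_smul, algebraMap_smul] }

/-- The stabiliser `𝔮_γ = {x ∈ 𝔮 : γ([x,y]) = 0 ∀ y}` of a linear functional `γ ∈ 𝔮*`. -/
def lieStab (K L : Type*) [CommRing K] [LieRing L] [LieAlgebra K L]
    (γ : Module.Dual K L) : Submodule K L where
  carrier := {x | ∀ y : L, γ ⁅x, y⁆ = 0}
  add_mem' {a b} ha hb := fun y => by rw [add_lie, map_add, ha y, hb y, add_zero]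
  zero_mem' := fun y => by rw [zero_lie, map_zero]
  smul_mem' c a ha := fun y => by rw [smul_lie, map_smul, ha y, smul_zero]

/-- The index of a Lie algebra: `ind 𝔮 = min_{γ ∈ 𝔮*} dim 𝔮_γ`. -/
noncomputable def lieIndex (K L : Type*) [CommRing K] [LieRing L] [LieAlgebra K L] : ℕ :=
  ⨅ γ : Module.Dual K L, Module.finrank K (lieStab K L γ)

section Helpers

/-- the structure map `v ↦ (j ↦ ∑ i, v i * g [b i, b j])` over an algebra `S`. -/
noncomputable def structMap {K Q : Type*} [Field K] [LieRing Q] [LieAlgebra K Q]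
    {ι : Type*} [Fintype ι] (b : Module.Basis ι K Q) {S : Type*} [CommRing S] [Algebra K S]
    (g : Q →ₗ[K] S) : (ι → S) →ₗ[S] (ι → S) where
  toFun v := fun j => ∑ i, v i * g ⁅b i, b j⁆
  map_add' v w := by
    funext j
    simp [add_mul, Finset.sum_add_distrib]
  map_smul' c v := by
    funext j
    simp [Finset.mul_sum, mul_assoc]

theorem structMap_apply {K Q : Type*} [Field K] [LieRing Q] [LieAlgebra K Q]
    {ι : Type*} [Fintype ι] (b : Module.Basis ι K Q) {S : Type*} [CommRing S] [Algebra K S]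
    (g : Q →ₗ[K] S) (v : ι → S) (j : ι) :
    structMap b g v j = ∑ i, v i * g ⁅b i, b j⁆ := rfl

theorem structMap_natural {K Q : Type*} [Field K] [LieRing Q] [LieAlgebra K Q]
    {ι : Type*} [Fintype ι] (b : Module.Basis ι K Q) {S T : Type*} [CommRing S] [Algebra K S]
    [CommRing T] [Algebra K T] (h : S →ₐ[K] T)
    (g : Q →ₗ[K] S) (v : ι → S) :
    structMap b (h.toLinearMap ∘ₗ g) (fun i => h (v i)) = fun j => h (structMap b g v j) := by
  funext j
  simp [structMap_apply]

theorem lieIndex_le {K L : Type*} [Field K] [LieRing L] [LieAlgebra K L]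
    (γ : Module.Dual K L) : lieIndex K L ≤ Module.finrank K (lieStab K L γ) :=
  ciInf_le (OrderBot.bddBelow _) γ

/-- dimension bound for `Q` itself -/
theorem finrank_range_structMap {K Q : Type*} [Field K] [LieRing Q] [LieAlgebra K Q]
    [FiniteDimensional K Q] {ι : Type*} [Fintype ι] (b : Module.Basis ι K Q)
    (γ : Q →ₗ[K] K) :
    Module.finrank K (LinearMap.range (structMap b γ)) + lieIndex K Q ≤ Fintype.card ι := by
  have h1 := LinearMap.finrank_range_add_finrank_ker (structMap b γ)
  rw [Module.finrank_fintype_fun_eq_card] at h1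
  have h2 := lieIndex_le (K := K) γ
  have h3 : (lieStab K Q γ).map b.equivFun.toLinearMap ≤ LinearMap.ker (structMap b γ) := by
    rintro _ ⟨x, hx, rfl⟩
    rw [LinearMap.mem_ker]
    funext j
    rw [structMap_apply]
    have := hx (b j)
    conv at this => lhs; rw [← b.sum_equivFun x]
    simp only [sum_lie, smul_lie, map_sum, map_smul, smul_eq_mul] at this
    exact this
  have h4 := Submodule.finrank_mono h3
  rw [LinearEquiv.finrank_map_eq b.equivFun] at h4
  omega

/-- Frobenius property of `K[t]/(p)`. -/
theorem exists_frobenius {K : Type*} [Field K] (p : Polynomial K) (hp : p.Monic)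
    (hdeg : 1 ≤ p.natDegree) :
    ∃ φ : (Polynomial K ⧸ Ideal.span {p}) →ₗ[K] K,
      ∀ g, (∀ f, φ (f * g) = 0) → g = 0 := by
  refine ⟨(Polynomial.lcoeff K (p.natDegree - 1)) ∘ₗ (AdjoinRoot.modByMonicHom hp), ?_⟩
  intro g hg
  by_contra hne
  obtain ⟨q, rfl⟩ := Ideal.Quotient.mk_surjective g
  set r := q %ₘ p with hr
  have hrq : (Ideal.Quotient.mk (Ideal.span {p}) q) = Ideal.Quotient.mk (Ideal.span {p}) r := by
    rw [Ideal.Quotient.eq, Ideal.mem_span_singleton]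
    exact ⟨q /ₘ p, by
      have := Polynomial.modByMonic_add_div q p
      rw [← hr] at this
      linear_combination -this⟩
  rw [hrq] at hg hne
  have hr0 : r ≠ 0 := by
    intro h
    exact hne (by rw [h, map_zero])
  have hlt : r.natDegree < p.natDegree :=
    Polynomial.natDegree_lt_natDegree hr0 (Polynomial.degree_modByMonic_lt q hp)
  have := hg (Ideal.Quotient.mk _ (X ^ (p.natDegree - 1 - r.natDegree)))
  rw [← map_mul] at this
  have hm : AdjoinRoot.modByMonicHom hp (Ideal.Quotient.mk (Ideal.span {p})
      (X ^ (p.natDegree - 1 - r.natDegree) * r)) =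
      (X ^ (p.natDegree - 1 - r.natDegree) * r) %ₘ p :=
    AdjoinRoot.modByMonicHom_mk hp _
  replace this : (Polynomial.lcoeff K (p.natDegree - 1)) (AdjoinRoot.modByMonicHom hp
      (Ideal.Quotient.mk (Ideal.span {p}) (X ^ (p.natDegree - 1 - r.natDegree) * r))) = 0 := this
  rw [hm, (Polynomial.modByMonic_eq_self_iff hp).2] at this
  · rw [Polynomial.lcoeff_apply, Polynomial.coeff_X_pow_mul', if_pos (by omega)] at this
    rw [show p.natDegree - 1 - (p.natDegree - 1 - r.natDegree) = r.natDegree by omega] at this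
    exact hr0 (Polynomial.leadingCoeff_eq_zero.1 this)
  · apply Polynomial.degree_lt_degree
    rw [Polynomial.natDegree_X_pow_mul _ hr0]
    omega

theorem frobenius_surj {K A : Type*} [Field K] [CommRing A] [Algebra K A] [FiniteDimensional K A]
    (φ : A →ₗ[K] K) (hφ : ∀ g, (∀ f, φ (f * g) = 0) → g = 0) (l : A →ₗ[K] K) :
    ∃ g : A, ∀ f, l f = φ (f * g) := by
  let F : A →ₗ[K] Module.Dual K A := (LinearMap.mul K A).flip.compr₂ φ
  have hF : Function.Injective F := by
    rw [← LinearMap.ker_eq_bot, LinearMap.ker_eq_bot']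
    intro g hg
    exact hφ g fun f => LinearMap.congr_fun hg f
  have hs : Function.Surjective F :=
    (LinearMap.injective_iff_surjective_of_finrank_eq_finrank
      (Subspace.dual_finrank_eq (K := K) (V := A)).symm).1 hF
  obtain ⟨g, hg⟩ := hs l
  exact ⟨g, fun f => (LinearMap.congr_fun hg f).symm⟩

theorem upper_bound {K A Q : Type*} [Field K] [CommRing A] [Algebra K A] [FiniteDimensional K A]
    [LieRing Q] [LieAlgebra K Q] [FiniteDimensional K Q]
    (φ : A →ₗ[K] K) (hφ : ∀ g, (∀ f, φ (f * g) = 0) → g = 0) :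
    lieIndex K (A ⊗[K] Q) ≤ Module.finrank K A * lieIndex K Q := by
  obtain ⟨γ, hγ⟩ : ∃ γ : Module.Dual K Q, Module.finrank K (lieStab K Q γ) = lieIndex K Q :=
    ciInf_mem (fun γ : Module.Dual K Q => Module.finrank K (lieStab K Q γ))
  let Γ : A ⊗[K] Q →ₗ[K] A := (TensorProduct.rid K A).toLinearMap ∘ₗ γ.lTensor A
  have hΓ : ∀ a x, Γ (a ⊗ₜ x) = γ x • a := fun a x => by simp [Γ]
  have hΓmul : ∀ (f : A) (x : A ⊗[K] Q) (y : Q), Γ ⁅x, f ⊗ₜ[K] y⁆ = f * Γ ⁅x, (1 : A) ⊗ₜ[K] y⁆ := by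
    intro f x y
    induction x with
    | zero => simp
    | add a b ha hb => rw [add_lie, add_lie, map_add, map_add, ha, hb, mul_add]
    | tmul a x =>
      rw [LieAlgebra.ExtendScalars.bracket_tmul, LieAlgebra.ExtendScalars.bracket_tmul, hΓ, hΓ]
      simp [mul_comm]
  refine (lieIndex_le (φ ∘ₗ Γ)).trans ?_
  let a := Module.finBasis K A
  let c : Fin (Module.finrank K A) → (A ⊗[K] Q →ₗ[K] Q) := fun k =>
    (TensorProduct.lid K Q).toLinearMap ∘ₗ (a.coord k).rTensor Q
  have hc : ∀ k f x, c k (f ⊗ₜ x) = a.repr f k • x := fun k f x => by simp [c]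
  have hcγ : ∀ k x y, γ ⁅c k x, y⁆ = a.coord k (Γ ⁅x, (1 : A) ⊗ₜ[K] y⁆) := by
    intro k x y
    induction x with
    | zero => simp
    | add u v hu hv => rw [add_lie, map_add, map_add, map_add, add_lie, map_add, hu, hv]
    | tmul f x =>
      rw [LieAlgebra.ExtendScalars.bracket_tmul, hc, hΓ]
      simp [mul_comm]
  have hsum : ∀ x, x = ∑ k, a k ⊗ₜ[K] c k x := by
    intro x
    induction x with
    | zero => simp
    | add u v hu hv =>
      simp only [map_add, TensorProduct.tmul_add, Finset.sum_add_distrib]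
      rw [← hu, ← hv]
    | tmul f x =>
      simp only [hc, TensorProduct.tmul_smul]
      simp only [TensorProduct.smul_tmul', ← TensorProduct.sum_tmul]
      rw [a.sum_repr]
  let F : lieStab K (A ⊗[K] Q) (φ ∘ₗ Γ) →ₗ[K] (Fin (Module.finrank K A) → lieStab K Q γ) :=
    LinearMap.pi fun k => ((c k) ∘ₗ (Submodule.subtype _)).codRestrict (lieStab K Q γ) (by
      rintro ⟨x, hx⟩ y
      change γ ⁅c k x, y⁆ = 0
      rw [hcγ, hφ (Γ ⁅x, (1 : A) ⊗ₜ[K] y⁆), map_zero]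
      intro f
      rw [← hΓmul]
      exact hx _)
  have hF : Function.Injective F := by
    intro x y hxy
    apply Subtype.ext
    rw [hsum x.1, hsum y.1]
    refine Finset.sum_congr rfl fun k _ => ?_
    have := congrArg Subtype.val (congrFun hxy k)
    change c k x.1 = c k y.1 at this
    rw [this]
  have := LinearMap.finrank_le_finrank_of_injective hF
  rw [Module.finrank_pi_fintype] at this
  simpa [hγ] using this

/-- the rank over `K[t]` is bounded by the generic rank -/
theorem exists_generators {K Q : Type*} [Field K] [Infinite K] [LieRing Q] [LieAlgebra K Q]
    [FiniteDimensional K Q] {ι : Type*} [Fintype ι] (b : Module.Basis ι K Q)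
    (G : Q →ₗ[K] K[X]) :
    ∃ (s : ℕ) (e : Fin s → (ι → K[X])), s + lieIndex K Q ≤ Fintype.card ι ∧
      ∀ v, ∃ c : Fin s → K[X], structMap b G v = ∑ k, c k • e k := by
  obtain ⟨s, ⟨bM, bN, f, d, hd⟩⟩ :=
    Submodule.smithNormalForm (Pi.basisFun K[X] ι) (LinearMap.range (structMap b G))
  refine ⟨s, fun k => (bN k : ι → K[X]), ?_, ?_⟩
  · have hd0 : ∀ k, d k ≠ 0 := by
      intro k h
      have := hd k
      rw [h, zero_smul] at this
      exact bN.ne_zero k (Subtype.ext this)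
    have hprod : ∏ k, d k ≠ 0 := Finset.prod_ne_zero_iff.2 fun k _ => hd0 k
    obtain ⟨z, hz⟩ : ∃ z, (∏ k, d k).eval z ≠ 0 := by
      by_contra! h
      exact hprod (Polynomial.funext fun z => by simpa using h z)
    have hz' : ∀ k, (d k).eval z ≠ 0 := by
      rw [Polynomial.eval_prod] at hz
      exact fun k => Finset.prod_ne_zero_iff.1 hz k (Finset.mem_univ k)
    let h : K[X] →ₐ[K] K := Polynomial.aeval z
    have hh : ∀ q, h q = q.eval z := fun q => Polynomial.coe_aeval_eq_eval z ▸ rfl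
    let w : ι → (ι → K) := fun j i => h (bM j i)
    have hspan : ⊤ ≤ Submodule.span K (Set.range w) := by
      intro v _
      have hv := bM.sum_repr (fun i => Polynomial.C (v i))
      have : v = ∑ j, h (bM.repr (fun i => Polynomial.C (v i)) j) • w j := by
        funext i
        have := congrArg h (congrFun hv i)
        simp only [Finset.sum_apply, map_sum, Pi.smul_apply, smul_eq_mul, map_mul] at this
        rw [hh (C (v i)), Polynomial.eval_C] at this
        simp [w, ← this]
      rw [this]
      exact Submodule.sum_mem _ fun j _ => Submodule.smul_mem _ _ (Submodule.subset_span ⟨j, rfl⟩)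
    have hli : LinearIndependent K w :=
      linearIndependent_of_top_le_span_of_card_eq_finrank hspan (by simp)
    let γ : Q →ₗ[K] K := h.toLinearMap ∘ₗ G
    have hmem : ∀ k, w (f k) ∈ LinearMap.range (structMap b γ) := by
      intro k
      obtain ⟨v, hv⟩ := (bN k).2
      refine ⟨((d k).eval z)⁻¹ • (fun i => h (v i)), ?_⟩
      rw [map_smul, structMap_natural, hv, hd k]
      funext i
      simp only [Pi.smul_apply, smul_eq_mul, map_mul, w]
      rw [hh (d k), inv_mul_cancel_left₀ (hz' k)]
    have hli2 : LinearIndependent K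
        (fun k => (⟨w (f k), hmem k⟩ : LinearMap.range (structMap b γ))) := by
      apply LinearIndependent.of_comp (Submodule.subtype _)
      exact hli.comp f f.injective
    have h1 := hli2.fintype_card_le_finrank
    have h2 := finrank_range_structMap b γ
    rw [Fintype.card_fin] at h1
    omega
  · intro v
    refine ⟨fun k => bN.repr ⟨structMap b G v, v, rfl⟩ k, ?_⟩
    have := congrArg Subtype.val (bN.sum_repr ⟨structMap b G v, v, rfl⟩)
    rw [Submodule.coe_sum] at this
    exact this.symm

theorem lower_bound {K A Q : Type*} [Field K] [Infinite K] [CommRing A] [Algebra K A]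
    [FiniteDimensional K A]
    [LieRing Q] [LieAlgebra K Q] [FiniteDimensional K Q]
    (φ : A →ₗ[K] K) (hφ : ∀ g, (∀ f, φ (f * g) = 0) → g = 0)
    (π : K[X] →ₐ[K] A) (hπ : Function.Surjective π) :
    Module.finrank K A * lieIndex K Q ≤ lieIndex K (A ⊗[K] Q) := by
  refine le_ciInf fun γ => ?_
  let b := Module.finBasis K Q
  choose g hg using fun i => frobenius_surj φ hφ (γ ∘ₗ (TensorProduct.mk K A Q).flip (b i))
  choose G0 hG0 using fun i => hπ (g i)
  let G : Q →ₗ[K] K[X] := b.constr K G0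
  have hG : ∀ f x, γ (f ⊗ₜ x) = φ (f * π (G x)) := by
    intro f x
    have : γ ∘ₗ (TensorProduct.mk K A Q f) =
        φ ∘ₗ (LinearMap.mulLeft K f) ∘ₗ π.toLinearMap ∘ₗ G := by
      refine b.ext fun i => ?_
      have := hg i f
      simp only [LinearMap.comp_apply, LinearMap.flip_apply] at this
      simp [G, hG0, ← this]
    exact LinearMap.congr_fun this x
  obtain ⟨s, e, hs, he⟩ := exists_generators b G
  let T : (Fin (Module.finrank K Q) → A) →ₗ[A] (Fin (Module.finrank K Q) → A) :=
    structMap b (π.toLinearMap ∘ₗ G)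
  let TK := T.restrictScalars K
  -- range bound
  let E : (Fin s → A) →ₗ[K] (Fin (Module.finrank K Q) → A) :=
    (Fintype.linearCombination A (fun k i => π (e k i))).restrictScalars K
  have hrange : LinearMap.range TK ≤ LinearMap.range E := by
    rintro _ ⟨v, rfl⟩
    choose v' hv' using fun i => hπ (v i)
    obtain ⟨c, hc⟩ := he v'
    refine ⟨fun k => π (c k), ?_⟩
    have hvv : v = fun i => π (v' i) := funext fun i => (hv' i).symm
    change _ = structMap b (π.toLinearMap ∘ₗ G) v
    rw [hvv, structMap_natural, hc]
    funext j
    simp [E, Fintype.linearCombination_apply]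
  have h1 : Module.finrank K (LinearMap.range TK) ≤ s * Module.finrank K A := by
    refine (Submodule.finrank_mono hrange).trans ((LinearMap.finrank_range_le E).trans ?_)
    rw [Module.finrank_pi_fintype]
    simp
  have h2 := LinearMap.finrank_range_add_finrank_ker TK
  rw [Module.finrank_pi_fintype] at h2
  simp only [Finset.sum_const, Finset.card_univ, Fintype.card_fin, smul_eq_mul] at h2 hs
  -- kernel embeds in the stabiliser
  let P : (Fin (Module.finrank K Q) → A) →ₗ[K] A ⊗[K] Q :=
    ((Algebra.TensorProduct.basis A b).equivFun.symm.toLinearMap).restrictScalars K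
  have hP : ∀ v, P v = ∑ i, v i ⊗ₜ[K] b i := by
    intro v
    simp [P, Module.Basis.equivFun_symm_apply, TensorProduct.smul_tmul']
  have hPinj : Function.Injective P := (Algebra.TensorProduct.basis A b).equivFun.symm.injective
  have hker : (LinearMap.ker TK).map P ≤ lieStab K (A ⊗[K] Q) γ := by
    rintro _ ⟨v, hv, rfl⟩
    have hv0 : ∀ j, ∑ i, v i * π (G ⁅b i, b j⁆) = 0 := fun j => congrFun hv j
    have key : ∀ y : Q, ∑ i, v i * π (G ⁅b i, y⁆) = 0 := by
      intro y
      rw [← b.sum_repr y]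
      simp only [lie_sum, lie_smul, map_sum, map_smul, Finset.mul_sum, mul_smul_comm]
      rw [Finset.sum_comm]
      refine Finset.sum_eq_zero fun j _ => ?_
      rw [← Finset.smul_sum, hv0, smul_zero]
    intro y
    induction y with
    | zero => simp
    | add y z hy hz => rw [lie_add, map_add, hy, hz, add_zero]
    | tmul f y =>
      rw [hP, sum_lie, map_sum]
      simp only [LieAlgebra.ExtendScalars.bracket_tmul, hG]
      rw [← map_sum]
      have : ∑ i, v i * f * π (G ⁅b i, y⁆) = f * ∑ i, v i * π (G ⁅b i, y⁆) := by
        rw [Finset.mul_sum]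
        exact Finset.sum_congr rfl fun i _ => by ring
      rw [this, key, mul_zero, map_zero]
  have h3 := Submodule.finrank_mono hker
  rw [← (Submodule.equivMapOfInjective P hPinj (LinearMap.ker TK)).finrank_eq] at h3
  have h4 := Nat.mul_le_mul_right (Module.finrank K A) hs
  rw [add_mul] at h4
  rw [mul_comm]
  omega

end Helpers

/-- For a monic polynomial `p` of degree `n ≥ 1`,
`ind (𝔮[t]/(p)) = n · ind 𝔮`. -/
theorem lieIndex_quotient_current_algebra
    (K : Type*) [Field K] [IsAlgClosed K] [CharZero K]
    (Q : Type*) [LieRing Q] [LieAlgebra K Q] [FiniteDimensional K Q]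
    (n : ℕ) (hn : 1 ≤ n) (p : Polynomial K) (hp : p.Monic) (hdeg : p.natDegree = n) :
    lieIndex K ((Polynomial K ⧸ Ideal.span {p}) ⊗[K] Q) = n * lieIndex K Q := by
  obtain ⟨φ, hφ⟩ := exists_frobenius p hp (by omega)
  have hfr : Module.finrank K (Polynomial K ⧸ Ideal.span {p}) = n := by
    have := (AdjoinRoot.powerBasis' hp).finrank
    rw [AdjoinRoot.powerBasis'_dim, hdeg] at this
    exact this
  have : FiniteDimensional K (Polynomial K ⧸ Ideal.span {p}) :=
    Module.finite_of_finrank_pos (by omega)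
  have : Infinite K := IsAlgClosed.instInfinite
  rw [← hfr]
  exact le_antisymm (upper_bound φ hφ)
    (lower_bound φ hφ (Ideal.Quotient.mkₐ K _) (Ideal.Quotient.mkₐ_surjective K _))
end

section
/- Let K be a field of characteristic 0, let 𝔤 be a finite-dimensional semisimple Lie algebra over K, and let p = ∏_{i=1}^{n} (t − a_i) ∈ K[t] with a_1, …, a_n ∈ K pairwise distinct (n ≥ 1). Then the Lie algebra (K[t]/(p)) ⊗_K 𝔤 is semisimple. -/
open TensorProduct Polynomial

/-- A Lie algebra whose homomorphisms onto algebras with trivial radical jointly separate points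
has trivial radical. -/
theorem hasTrivialRadical_of_separating {K L G ι : Type*} [Field K] [LieRing L] [LieAlgebra K L]
    [LieRing G] [LieAlgebra K G] [LieAlgebra.HasTrivialRadical K G]
    (f : ι → L →ₗ⁅K⁆ G) (hf : ∀ i, Function.Surjective (f i))
    (hs : ∀ x, (∀ i, f i x = 0) → x = 0) : LieAlgebra.HasTrivialRadical K L := by
  rw [LieAlgebra.hasTrivialRadical_iff_no_abelian_ideals]
  intro I hI
  rw [LieSubmodule.eq_bot_iff]
  intro x hx
  apply hs
  intro i
  have hab : IsLieAbelian (LieIdeal.map (f i) I) := by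
    constructor
    rintro ⟨u, hu⟩ ⟨v, hv⟩
    obtain ⟨⟨y, hy⟩, rfl⟩ := LieIdeal.mem_map_of_surjective (hf i) hu
    obtain ⟨⟨z, hz⟩, rfl⟩ := LieIdeal.mem_map_of_surjective (hf i) hv
    have h0 : ⁅y, z⁆ = 0 := by
      have := hI.trivial ⟨y, hy⟩ ⟨z, hz⟩
      exact congrArg Subtype.val this
    apply Subtype.ext
    change ⁅f i y, f i z⁆ = 0
    rw [← LieHom.map_lie, h0, map_zero]
  have hbot := (LieAlgebra.hasTrivialRadical_iff_no_abelian_ideals K G).1 inferInstance _ hab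
  have := LieIdeal.mem_map (f := f i) hx
  rw [hbot] at this
  simpa using this

/-- The Lie homomorphism `A ⊗ G → G` induced by a point `A → K`. -/
noncomputable def evalLie {K A G : Type*} [Field K] [CommRing A] [Algebra K A] [LieRing G]
    [LieAlgebra K G] (φ : A →ₐ[K] K) : A ⊗[K] G →ₗ⁅K⁆ G :=
  { (TensorProduct.lid K G).toLinearMap ∘ₗ LinearMap.rTensor G φ.toLinearMap with
    map_lie' := by
      intro x y
      simp only [AddHom.toFun_eq_coe, LinearMap.coe_toAddHom]
      induction x using TensorProduct.induction_on with
      | zero => simp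
      | add x₁ x₂ h₁ h₂ => simp only [add_lie, map_add, h₁, h₂]
      | tmul s u =>
        induction y using TensorProduct.induction_on with
        | zero => simp
        | add y₁ y₂ h₁ h₂ => simp only [lie_add, map_add, h₁, h₂]
        | tmul t v =>
          simp only [LieAlgebra.ExtendScalars.bracket_tmul, LinearMap.coe_comp,
            Function.comp_apply, LinearMap.rTensor_tmul, AlgHom.toLinearMap_apply,
            LinearEquiv.coe_coe, TensorProduct.lid_tmul, map_mul, mul_smul, smul_lie, lie_smul]
          exact smul_comm _ _ _ }

theorem evalLie_tmul {K A G : Type*} [Field K] [CommRing A] [Algebra K A] [LieRing G]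
    [LieAlgebra K G] (φ : A →ₐ[K] K) (s : A) (u : G) : evalLie φ (s ⊗ₜ[K] u) = φ s • u := by
  change TensorProduct.lid K G (LinearMap.rTensor G φ.toLinearMap (s ⊗ₜ[K] u)) = _
  simp

theorem evalLie_separating {K A G ι : Type*} [Field K] [CommRing A] [Algebra K A] [LieRing G]
    [LieAlgebra K G] (φ : ι → A →ₐ[K] K) (hφ : ∀ s, (∀ i, φ i s = 0) → s = 0)
    (x : A ⊗[K] G) (hx : ∀ i, evalLie (φ i) x = 0) : x = 0 := by
  let b := Module.Basis.ofVectorSpace K G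
  let B := Algebra.TensorProduct.basis A b
  have key : ∀ i (y : A ⊗[K] G) j, φ i (B.repr y j) = b.repr (evalLie (φ i) y) j := by
    intro i y j
    induction y using TensorProduct.induction_on with
    | zero => simp
    | add y₁ y₂ h₁ h₂ => simp [h₁, h₂]
    | tmul t v => simp [B, evalLie_tmul]
  apply B.repr.injective
  rw [map_zero]
  ext j
  apply hφ
  intro i
  rw [key, hx]
  simp

/-- If `𝔤` is a finite-dimensional semisimple Lie algebra over a field of characteristic zero
and `p = ∏ (t - aᵢ)` has pairwise distinct roots, then `𝔤[t]/(p)` is semisimple. -/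
theorem isSemisimple_quotient_current_algebra
    (K : Type*) [Field K] [CharZero K]
    (G : Type*) [LieRing G] [LieAlgebra K G] [FiniteDimensional K G]
    [LieAlgebra.IsSemisimple K G]
    (n : ℕ) (hn : 1 ≤ n) (a : Fin n → K) (ha : Function.Injective a)
    (p : Polynomial K) (hp : p = ∏ i, (X - C (a i))) :
    LieAlgebra.IsSemisimple K ((Polynomial K ⧸ Ideal.span {p}) ⊗[K] G) := by
  have hpm : p.Monic := hp ▸ monic_prod_of_monic _ _ fun i _ => monic_X_sub_C _
  have hfin : Module.Finite K (Polynomial K ⧸ Ideal.span {p}) := hpm.finite_quotient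
  let φ : Fin n → (Polynomial K ⧸ Ideal.span {p}) →ₐ[K] K := fun i =>
    Ideal.Quotient.liftₐ (Ideal.span {p}) (Polynomial.aeval (a i)) (by
      intro q hq
      obtain ⟨r, rfl⟩ := Ideal.mem_span_singleton.1 hq
      rw [map_mul, hp]
      simp [Finset.prod_eq_zero (Finset.mem_univ i)])
  have hφ : ∀ s, (∀ i, φ i s = 0) → s = 0 := by
    intro s hs
    obtain ⟨q, rfl⟩ := Ideal.Quotient.mk_surjective s
    rw [Ideal.Quotient.eq_zero_iff_mem, Ideal.mem_span_singleton, hp]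
    apply Finset.prod_dvd_of_coprime
    · intro i _ j _ hij
      exact pairwise_coprime_X_sub_C ha hij
    · intro i _
      rw [dvd_iff_isRoot]
      have := hs i
      simpa [φ] using this
  have htr : LieAlgebra.HasTrivialRadical K ((Polynomial K ⧸ Ideal.span {p}) ⊗[K] G) := by
    refine hasTrivialRadical_of_separating (fun i => evalLie (φ i)) (fun i g => ?_)
      (evalLie_separating φ hφ)
    exact ⟨1 ⊗ₜ g, by simp [evalLie_tmul]⟩
  infer_instance
end

section
/- Let K be a field, let p_1, p_2 ∈ K[t] be monic of degree n ≥ 2 with deg(p_1 − p_2) ≤ 1, and let c_1, c_2 ∈ K with c_1 + c_2 = 1 (so that c_1·p_1 + c_2·p_2 is again monic of degree n). Then for every h ∈ K[t] with deg h ≤ 2n − 2 one has c_1·(h %ₘ p_1) + c_2·(h %ₘ p_2) = h %ₘ (c_1·p_1 + c_2·p_2). -/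
open Polynomial

/-- If `p₁, p₂` are monic of degree `n ≥ 2` with `deg(p₁ - p₂) ≤ 1`, `c₁ + c₂ = 1`, and
`deg h ≤ 2n - 2`, then `c₁·(h %ₘ p₁) + c₂·(h %ₘ p₂) = h %ₘ (c₁·p₁ + c₂·p₂)`. -/
theorem modByMonic_convex_combination
    (K : Type*) [Field K] (n : ℕ) (hn : 2 ≤ n)
    (p₁ p₂ : Polynomial K) (h₁ : p₁.Monic) (h₂ : p₂.Monic)
    (hd₁ : p₁.natDegree = n) (hd₂ : p₂.natDegree = n)
    (hdiff : (p₁ - p₂).degree ≤ 1)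
    (c₁ c₂ : K) (hc : c₁ + c₂ = 1)
    (h : Polynomial K) (hh : h.degree ≤ (2 * n - 2 : ℕ)) :
    c₁ • (h %ₘ p₁) + c₂ • (h %ₘ p₂) = h %ₘ (c₁ • p₁ + c₂ • p₂) := by
  have hP1 : p₁.degree = (n : ℕ) := by rw [degree_eq_natDegree h₁.ne_zero, hd₁]
  have hP2 : p₂.degree = (n : ℕ) := by rw [degree_eq_natDegree h₂.ne_zero, hd₂]
  have hlt : (p₁ - p₂).degree < p₂.degree := by
    rw [hP2]
    refine lt_of_le_of_lt hdiff ?_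
    exact_mod_cast (by omega : 1 < n)
  have hq : ((p₁ - p₂) * (h /ₘ p₁)).degree < (n : ℕ) := by
    have hqn : (h /ₘ p₁).natDegree ≤ n - 2 := by
      rw [natDegree_divByMonic _ h₁, hd₁]
      have := natDegree_le_of_degree_le hh
      omega
    have hdn : (p₁ - p₂).natDegree ≤ 1 := natDegree_le_of_degree_le (by exact_mod_cast hdiff)
    refine lt_of_le_of_lt (degree_le_of_natDegree_le
      (natDegree_mul_le.trans (add_le_add hdn hqn))) ?_
    exact_mod_cast (by omega : 1 + (n - 2) < n)
  have e1 := modByMonic_add_div h p₁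
  have hr1 : (h %ₘ p₁).degree < (n : ℕ) := hP1 ▸ degree_modByMonic_lt h h₁
  have hr2 : (h %ₘ p₁ + (p₁ - p₂) * (h /ₘ p₁)).degree < (n : ℕ) :=
    (degree_add_le _ _).trans_lt (max_lt hr1 hq)
  have e2 := (div_modByMonic_unique (f := h) (h /ₘ p₁) (h %ₘ p₁ + (p₁ - p₂) * (h /ₘ p₁)) h₂
    ⟨by linear_combination e1, by rw [hP2]; exact hr2⟩).2
  have hC : (C c₁ + C c₂ : K[X]) = 1 := by rw [← C_add, hc, C_1]
  have hP : c₁ • p₁ + c₂ • p₂ = p₂ + c₁ • (p₁ - p₂) := by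
    simp only [smul_eq_C_mul]
    linear_combination p₂ * hC
  have hlt' : (c₁ • (p₁ - p₂)).degree < p₂.degree := (degree_smul_le _ _).trans_lt hlt
  have hPm : (c₁ • p₁ + c₂ • p₂).Monic := hP ▸ h₂.add_of_left hlt'
  have hPd : (c₁ • p₁ + c₂ • p₂).degree = (n : ℕ) := by
    rw [hP, degree_add_eq_left_of_degree_lt hlt', hP2]
  rw [e2]
  refine (div_modByMonic_unique (h /ₘ p₁) _ hPm ⟨?_, ?_⟩).2.symm
  · simp only [smul_eq_C_mul]
    linear_combination e1 + (h %ₘ p₁ + p₁ * (h /ₘ p₁)) * hC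
  · rw [hPd]
    exact (degree_add_le _ _).trans_lt
      (max_lt ((degree_smul_le _ _).trans_lt hr1) ((degree_smul_le _ _).trans_lt hr2))
end
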